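/- arXiv:2009.13024 — 4 statements merged into one kernel-verified Lean document; each statement's English description precedes it below -/
import Mathlib

section
/- Let p be an odd prime and let (a_i, b_i) ∈ ℤ² for i = 1, ..., 3p-3 be such that for each i, p does not divide both a_i and b_i. Then the system a_1 x_1^{p-1} + ... + a_{3p-3} x_{3p-3}^{p-1} ≡ 0 (mod p), b_1 x_1^{p-1} + ... + b_{3p-3} x_{3p-3}^{p-1} ≡ 0 (mod p) has a solution with (x_1, ..., x_p) ≢ (0, ..., 0) (mod p). -/
open Finset in
/-- signed sum over subsets -/
noncomputable def sgnSum {ι K : Type*} [DecidableEq ι] [Field K] (F : Finset ι → K)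
    (X : Finset ι) : K := ∑ T ∈ X.powerset, (-1) ^ T.card * F T

theorem sgnSum_insert {ι K : Type*} [DecidableEq ι] [Field K] (F : Finset ι → K)
    (X : Finset ι) (i : ι) (hi : i ∉ X) :
    sgnSum F (insert i X) = sgnSum F X + ∑ T ∈ X.powerset, (-1) ^ (insert i T).card * F (insert i T) := by
  unfold sgnSum
  rw [Finset.sum_powerset_insert hi]

theorem sgnSum_linear {ι K : Type*} [DecidableEq ι] [Field K] (F : Finset ι → K)
    (c : ι → K) (X : Finset ι) :
    sgnSum (fun T => (∑ i ∈ T, c i) * F T) X =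
      ∑ i ∈ X, c i * (sgnSum F X - sgnSum F (X.erase i)) := by
  have h1 : ∀ i ∈ X, sgnSum F X - sgnSum F (X.erase i) =
      ∑ T ∈ X.powerset, if i ∈ T then (-1) ^ T.card * F T else 0 := by
    intro i hi
    have hX : X = insert i (X.erase i) := (Finset.insert_erase hi).symm
    have h2 := sgnSum_insert F (X.erase i) i (Finset.notMem_erase i X)
    rw [← hX] at h2
    rw [h2, add_sub_cancel_left]
    conv_rhs => rw [hX]
    rw [Finset.sum_powerset_insert (Finset.notMem_erase i X)]
    rw [Finset.sum_eq_zero (s := (X.erase i).powerset)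
      (f := fun T => if i ∈ T then (-1) ^ T.card * F T else 0), zero_add]
    · refine Finset.sum_congr rfl fun T _ => ?_
      rw [if_pos (Finset.mem_insert_self i T)]
    · intro T hT
      rw [if_neg]
      intro h
      exact Finset.notMem_erase i X (Finset.mem_powerset.1 hT h)
  rw [Finset.sum_congr rfl fun i hi => by rw [h1 i hi]]
  simp_rw [Finset.mul_sum]
  rw [Finset.sum_comm]
  unfold sgnSum
  refine Finset.sum_congr rfl fun T hT => ?_
  rw [Finset.mem_powerset] at hT
  rw [← Finset.sum_subset hT]
  · beta_reduce
    rw [Finset.sum_mul, Finset.mul_sum]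
    refine Finset.sum_congr rfl fun i hi => ?_
    rw [if_pos hi]; ring
  · intro i _ hi
    rw [if_neg hi, mul_zero]

/-- degree at most k -/
def DegLE {ι K : Type*} [DecidableEq ι] [Field K] (F : Finset ι → K) (k : ℕ) : Prop :=
  ∀ X : Finset ι, k < X.card → sgnSum F X = 0

theorem DegLE.mono {ι K : Type*} [DecidableEq ι] [Field K] {F : Finset ι → K} {k l : ℕ}
    (h : DegLE F k) (hkl : k ≤ l) : DegLE F l := fun X hX => h X (by omega)

theorem DegLE.sub {ι K : Type*} [DecidableEq ι] [Field K] {F G : Finset ι → K} {k : ℕ}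
    (hF : DegLE F k) (hG : DegLE G k) : DegLE (fun T => F T - G T) k := by
  intro X hX
  have h1 := hF X hX
  have h2 := hG X hX
  unfold sgnSum at *
  simp only [mul_sub, Finset.sum_sub_distrib, h1, h2, sub_zero]

theorem DegLE.lin_mul {ι K : Type*} [DecidableEq ι] [Field K] {F : Finset ι → K} {k : ℕ}
    (hF : DegLE F k) (c : ι → K) : DegLE (fun T => (∑ i ∈ T, c i) * F T) (k + 1) := by
  intro X hX
  rw [sgnSum_linear]
  refine Finset.sum_eq_zero fun i hi => ?_
  rw [hF X (by omega), hF (X.erase i) (by rw [Finset.card_erase_of_mem hi]; omega)]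
  simp

theorem DegLE.pow_mul {ι K : Type*} [DecidableEq ι] [Field K] {F : Finset ι → K} {k : ℕ}
    (hF : DegLE F k) (c : ι → K) (n : ℕ) :
    DegLE (fun T => (∑ i ∈ T, c i) ^ n * F T) (k + n) := by
  induction n with
  | zero => simpa using hF
  | succ n ih =>
    have := ih.lin_mul c
    simp only [← mul_assoc, ← pow_succ'] at this
    exact this

theorem DegLE.one {ι K : Type*} [DecidableEq ι] [Field K] :
    DegLE (fun _ : Finset ι => (1 : K)) 0 := by
  intro X hX
  unfold sgnSum
  have h := Finset.sum_powerset_neg_one_pow_card_of_nonempty (Finset.card_pos.1 hX)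
  have h2 := congrArg (Int.cast : ℤ → K) h
  push_cast at h2
  simpa using h2

theorem DegLE.ind {ι K : Type*} [DecidableEq ι] [Field K] (a b : ι → K) (n : ℕ) :
    DegLE (fun T : Finset ι => (1 - (∑ i ∈ T, b i) ^ n) - (∑ i ∈ T, a i) ^ n * (1 - (∑ i ∈ T, b i) ^ n))
      (n + n) := by
  have h1 : DegLE (fun T : Finset ι => 1 - (∑ i ∈ T, b i) ^ n) n := by
    have h := (DegLE.one (ι := ι) (K := K)).pow_mul b n
    rw [zero_add] at h
    have := (DegLE.one (ι := ι) (K := K)).mono (Nat.zero_le n) |>.sub h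
    simpa using this
  exact (h1.mono (by omega)).sub (h1.pow_mul a n)

theorem sum_erase_powersetCard {ι K : Type*} [DecidableEq ι] [Field K] (f : Finset ι → K)
    (U : Finset ι) (n : ℕ) :
    ∑ V ∈ U.powersetCard (n + 1), ∑ u ∈ V, f (V.erase u) =
      ((U.card - n : ℕ) : K) * ∑ V ∈ U.powersetCard n, f V := by
  have h : ∀ V ∈ U.powersetCard n, ((U.card - n : ℕ) : K) * f V = ∑ u ∈ U \ V, f V := by
    intro V hV
    rw [Finset.mem_powersetCard] at hV
    rw [Finset.sum_const, Finset.card_sdiff_of_subset hV.1, hV.2, nsmul_eq_mul]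
  rw [Finset.mul_sum, Finset.sum_congr rfl h, Finset.sum_sigma', Finset.sum_sigma']
  refine Finset.sum_bij' (fun x _ => ⟨x.1.erase x.2, x.2⟩) (fun x _ => ⟨insert x.2 x.1, x.2⟩)
    ?_ ?_ ?_ ?_ ?_
  · rintro ⟨V, u⟩ h
    simp only [Finset.mem_sigma, Finset.mem_powersetCard, Finset.mem_sdiff] at h ⊢
    obtain ⟨⟨h1, h2⟩, h3⟩ := h
    refine ⟨⟨(Finset.erase_subset _ _).trans h1, ?_⟩, h1 h3, Finset.notMem_erase _ _⟩
    rw [Finset.card_erase_of_mem h3]; omega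
  · rintro ⟨V, u⟩ h
    simp only [Finset.mem_sigma, Finset.mem_powersetCard, Finset.mem_sdiff] at h ⊢
    obtain ⟨⟨h1, h2⟩, h3, h4⟩ := h
    refine ⟨⟨Finset.insert_subset h3 h1, ?_⟩, Finset.mem_insert_self _ _⟩
    rw [Finset.card_insert_of_notMem h4, h2]
  · rintro ⟨V, u⟩ h
    simp only [Finset.mem_sigma] at h
    simp [Finset.insert_erase h.2]
  · rintro ⟨V, u⟩ h
    simp only [Finset.mem_sigma, Finset.mem_sdiff] at h
    simp [Finset.erase_insert h.2.2]
  · rintro ⟨V, u⟩ h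
    rfl

/-- Injectivity of the inclusion map between levels `d` and `d+1`. -/
theorem level_inj {ι K : Type*} [DecidableEq ι] [Field K] (W : Finset ι) (h : Finset ι → K)
    (d : ℕ) (hd : ∀ j ≤ d, ((j + 1 : ℕ) : K) ≠ 0) (hW : 2 * d + 1 ≤ W.card)
    (heq : ∀ S ⊆ W, S.card = d + 1 → ∑ i ∈ S, h (S.erase i) = 0) :
    ∀ T ⊆ W, T.card = d → h T = 0 := by
  intro T hT hTc
  obtain ⟨U, hU, hUc⟩ := Finset.exists_subset_card_eq (s := W \ T) (n := d + 1)
    (by rw [Finset.card_sdiff_of_subset hT]; omega)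
  have hUW : U ⊆ W := hU.trans Finset.sdiff_subset
  have hdis : Disjoint T U := (Finset.disjoint_sdiff).mono_right hU
  have key : ∀ n ≤ d, ∀ A ⊆ T, A.card = n →
      ∑ V ∈ U.powersetCard (d - n), h (A ∪ V) = 0 := by
    intro n
    induction n with
    | zero =>
      intro _ A hA hAc
      rw [Finset.card_eq_zero] at hAc
      subst hAc
      have h1 := sum_erase_powersetCard h U d
      rw [hUc, Finset.sum_eq_zero] at h1
      · simpa using h1.symm
      · intro V hV
        rw [Finset.mem_powersetCard] at hV
        exact heq V (hV.1.trans hUW) hV.2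
    | succ n ih =>
      intro hn A hA hAc
      have h1 := sum_erase_powersetCard (fun V => h (A ∪ V)) U (d - (n + 1))
      have h2 : ∑ V ∈ U.powersetCard (d - (n + 1) + 1), ∑ u ∈ V, h (A ∪ V.erase u) = 0 := by
        have h3 : ∀ V ∈ U.powersetCard (d - (n + 1) + 1), ∑ u ∈ V, h (A ∪ V.erase u) =
            - ∑ x ∈ A, h (A.erase x ∪ V) := by
          intro V hV
          rw [Finset.mem_powersetCard] at hV
          have hAV : Disjoint A V := hdis.mono hA hV.1
          have h4 := heq (A ∪ V) (Finset.union_subset (hA.trans hT) (hV.1.trans hUW))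
            (by rw [Finset.card_union_of_disjoint hAV]; omega)
          rw [Finset.sum_union hAV] at h4
          rw [eq_neg_iff_add_eq_zero, add_comm, ← h4]
          congr 1
          · refine Finset.sum_congr rfl fun x hx => ?_
            rw [Finset.erase_union_distrib,
              Finset.erase_eq_of_notMem (Finset.disjoint_left.1 hAV hx)]
          · refine Finset.sum_congr rfl fun x hx => ?_
            rw [Finset.erase_union_distrib,
              Finset.erase_eq_of_notMem (Finset.disjoint_right.1 hAV hx)]
        rw [Finset.sum_congr rfl h3, Finset.sum_neg_distrib, Finset.sum_comm, neg_eq_zero]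
        refine Finset.sum_eq_zero fun x hx => ?_
        have := ih (by omega) (A.erase x) ((Finset.erase_subset _ _).trans hA)
          (by rw [Finset.card_erase_of_mem hx]; omega)
        rwa [show d - n = d - (n + 1) + 1 by omega] at this
      rw [h2] at h1
      rw [hUc, show d + 1 - (d - (n + 1)) = (n + 1) + 1 by omega] at h1
      exact (mul_eq_zero.1 h1.symm).resolve_left (hd _ hn)
  have := key d le_rfl T (Finset.Subset.refl _) hTc
  simpa using this

theorem level_inj' {ι K : Type*} [DecidableEq ι] [Field K] (W : Finset ι) (e : Finset ι → K)
    (c : ι → K) (hc : ∀ i, c i ≠ 0)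
    (d : ℕ) (hd : ∀ j ≤ d, ((j + 1 : ℕ) : K) ≠ 0) (hW : 2 * d + 1 ≤ W.card)
    (heq : ∀ S ⊆ W, S.card = d + 1 → ∑ i ∈ S, c i * e (S.erase i) = 0) :
    ∀ T ⊆ W, T.card = d → e T = 0 := by
  intro T hT hTc
  have hP : ∀ S : Finset ι, ∏ i ∈ S, c i ≠ 0 := fun S => Finset.prod_ne_zero_iff.2 fun i _ => hc i
  have := level_inj W (fun S => e S / ∏ i ∈ S, c i) d hd hW ?_ T hT hTc
  · exact (div_eq_zero_iff.1 this).resolve_right (hP T)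
  · intro S hS hSc
    have h1 := heq S hS hSc
    have h2 : ∀ i ∈ S, e (S.erase i) / ∏ i ∈ S.erase i, c i =
        (∏ i ∈ S, c i)⁻¹ * (c i * e (S.erase i)) := by
      intro i hi
      rw [← Finset.mul_prod_erase S c hi]
      have := hP (S.erase i)
      have := hc i
      field_simp
    rw [Finset.sum_congr rfl h2, ← Finset.mul_sum, h1, mul_zero]

/-- Main combinatorial statement. -/
theorem main_comb {ι K : Type*} [DecidableEq ι] [Field K] (p : ℕ) (hp : 3 ≤ p)
    (hK : ∀ j, 0 < j → j < p → (j : K) ≠ 0)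
    (V W : Finset ι) (hVW : Disjoint V W) (hV : V.card = p) (hW : W.card = 2 * p - 3)
    (c : ι → K) (hc : ∀ i, c i ≠ 0) (F : Finset ι → K)
    (hF : DegLE F ((p - 1) + (p - 1))) (hF0 : F ∅ = 1)
    (hF1 : ∀ T, (∑ i ∈ T, c i) * F T = 0)
    (hno : ∀ T, (∃ i ∈ T, i ∈ V) → F T = 0) : False := by
  have htop : ∀ S ⊆ W, p - 1 ≤ S.card → sgnSum F S = 0 := by
    intro S hS hSc
    have h1 := hF (V ∪ S) (by
      rw [Finset.card_union_of_disjoint (hVW.mono_right hS)]; omega)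
    rw [← h1]
    unfold sgnSum
    refine Finset.sum_subset (Finset.powerset_mono.2 Finset.subset_union_right) ?_
    intro T hT hT2
    rw [Finset.mem_powerset] at hT hT2
    rw [hno T, mul_zero]
    obtain ⟨i, hi, hi2⟩ := Finset.not_subset.1 hT2
    exact ⟨i, hi, (Finset.mem_union.1 (hT hi)).resolve_right hi2⟩
  have hall : ∀ k ≤ p - 1, ∀ S ⊆ W, p - 1 - k ≤ S.card → sgnSum F S = 0 := by
    intro k
    induction k with
    | zero => intro _; simpa using htop
    | succ k ih =>
      intro hk S hS hSc
      rcases Nat.lt_or_ge (p - 1 - (k + 1)) S.card with h | h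
      · exact ih (by omega) S hS (by omega)
      · refine level_inj' W (sgnSum F) c hc (p - 1 - (k + 1)) ?_ (by omega) ?_ S hS (by omega)
        · intro j hj
          exact hK _ (by omega) (by omega)
        · intro S hS hSc
          have h1 := sgnSum_linear F c S
          rw [ih (by omega) S hS (by omega)] at h1
          have h2 : sgnSum (fun T => (∑ i ∈ T, c i) * F T) S = 0 := by
            unfold sgnSum
            simp [hF1]
          rw [h2] at h1
          simpa using h1.symm
  have := hall (p - 1) le_rfl ∅ (Finset.empty_subset _) (by simp)
  simp [sgnSum, hF0] at this

theorem stmt_4 (p : ℕ) (hp : p.Prime) (hodd : Odd p)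
    (a b : Fin (3 * p - 3) → ℤ)
    (hab : ∀ i, ¬ ((p : ℤ) ∣ a i ∧ (p : ℤ) ∣ b i)) :
    ∃ x : Fin (3 * p - 3) → ℤ,
      (∑ i, a i * x i ^ (p - 1)) ≡ 0 [ZMOD (p : ℤ)] ∧
      (∑ i, b i * x i ^ (p - 1)) ≡ 0 [ZMOD (p : ℤ)] ∧
      ∃ i : Fin (3 * p - 3), (i : ℕ) < p ∧ ¬ (p : ℤ) ∣ x i := by
  haveI : Fact p.Prime := ⟨hp⟩
  have hp3 : 3 ≤ p := by
    have := hp.two_le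
    obtain ⟨k, hk⟩ := hodd
    omega
  by_contra hcon
  -- no zero-sum subset meets the first `p` indices
  have hno : ∀ T : Finset (Fin (3 * p - 3)), (∃ i ∈ T, (i : ℕ) < p) →
      ¬ ((∑ i ∈ T, (a i : ZMod p)) = 0 ∧ (∑ i ∈ T, (b i : ZMod p)) = 0) := by
    rintro T ⟨i, hiT, hip⟩ ⟨h1, h2⟩
    apply hcon
    have hz : ∀ f : Fin (3 * p - 3) → ℤ, (∑ i ∈ T, (f i : ZMod p)) = 0 →
        (∑ i, f i * (if i ∈ T then (1 : ℤ) else 0) ^ (p - 1)) ≡ 0 [ZMOD (p : ℤ)] := by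
      intro f hf
      rw [← ZMod.intCast_eq_intCast_iff]
      have h0 : p - 1 ≠ 0 := by omega
      simp only [ite_pow, one_pow, zero_pow h0, mul_ite, mul_one, mul_zero]
      push_cast
      simpa [Finset.sum_ite_mem] using hf
    refine ⟨fun i => if i ∈ T then 1 else 0, hz a h1, hz b h2, i, hip, ?_⟩
    beta_reduce
    rw [if_pos hiT]
    intro h
    have := Int.le_of_dvd one_pos h
    omega
  let K := RatFunc (ZMod p)
  let φ : Polynomial (ZMod p) →+* K := algebraMap (Polynomial (ZMod p)) K
  have hφ : Function.Injective φ := RatFunc.algebraMap_injective (ZMod p)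
  let ψ : ZMod p →+* K := φ.comp Polynomial.C
  have hψ : Function.Injective ψ := ψ.injective
  have hpoly : ∀ u v : ZMod p, ψ u + φ Polynomial.X * ψ v = 0 ↔ u = 0 ∧ v = 0 := by
    intro u v
    constructor
    · intro h
      have h' : φ (Polynomial.C u + Polynomial.X * Polynomial.C v) = φ 0 := by
        rw [map_add, map_mul, map_zero]; exact h
      have h2 := hφ h'
      have e0 := congrArg (fun q => Polynomial.coeff q 0) h2
      have e1 := congrArg (fun q => Polynomial.coeff q 1) h2
      simp [Polynomial.coeff_C] at e0 e1
      exact ⟨e0, e1⟩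
    · rintro ⟨rfl, rfl⟩
      simp
  have hsum : ∀ T : Finset (Fin (3 * p - 3)),
      ∑ i ∈ T, (ψ (a i : ZMod p) + φ Polynomial.X * ψ (b i : ZMod p)) =
        ψ (∑ i ∈ T, (a i : ZMod p)) + φ Polynomial.X * ψ (∑ i ∈ T, (b i : ZMod p)) := by
    intro T
    rw [Finset.sum_add_distrib, map_sum, map_sum, Finset.mul_sum]
  have hpow : ∀ u : ZMod p, u ≠ 0 → ψ u ^ (p - 1) = 1 := by
    intro u hu
    rw [← map_pow, ZMod.pow_card_sub_one_eq_one hu, map_one]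
  have h0 : p - 1 ≠ 0 := by omega
  let F : Finset (Fin (3 * p - 3)) → K := fun T =>
    (1 - (∑ i ∈ T, ψ (b i : ZMod p)) ^ (p - 1)) -
      (∑ i ∈ T, ψ (a i : ZMod p)) ^ (p - 1) * (1 - (∑ i ∈ T, ψ (b i : ZMod p)) ^ (p - 1))
  have hFz : ∀ T : Finset (Fin (3 * p - 3)),
      ¬ ((∑ i ∈ T, (a i : ZMod p)) = 0 ∧ (∑ i ∈ T, (b i : ZMod p)) = 0) → F T = 0 := by
    intro T hT
    simp only [F]
    rw [← map_sum, ← map_sum]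
    by_cases hb : (∑ i ∈ T, (b i : ZMod p)) = 0
    · have ha : (∑ i ∈ T, (a i : ZMod p)) ≠ 0 := fun h => hT ⟨h, hb⟩
      rw [hpow _ ha]; ring
    · rw [hpow _ hb]; ring
  have hlt : p ≤ 3 * p - 3 := by omega
  have hcardV : (Finset.univ.filter fun i : Fin (3 * p - 3) => (i : ℕ) < p).card = p := by
    rw [Fin.card_filter_val_lt]; omega
  refine main_comb (K := K) p hp3 ?_ (Finset.univ.filter fun i : Fin (3 * p - 3) => (i : ℕ) < p)
    (Finset.univ.filter fun i : Fin (3 * p - 3) => ¬ (i : ℕ) < p)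
    (Finset.disjoint_filter_filter_not _ _ _) hcardV ?_
    (fun i => ψ (a i : ZMod p) + φ Polynomial.X * ψ (b i : ZMod p)) ?_ F
    (DegLE.ind _ _ _) ?_ ?_ ?_
  · intro j hj hjp h
    have h1 : ψ (j : ZMod p) = ψ 0 := by rw [map_natCast, map_zero]; exact h
    have h2 := (ZMod.natCast_eq_zero_iff j p).1 (hψ h1)
    exact absurd (Nat.le_of_dvd hj h2) (by omega)
  · have := Finset.card_filter_add_card_filter_not (s := (Finset.univ : Finset (Fin (3 * p - 3))))
      (fun i : Fin (3 * p - 3) => (i : ℕ) < p)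
    rw [hcardV, Finset.card_univ, Fintype.card_fin] at this
    omega
  · intro i h
    rw [hpoly] at h
    exact hab i ⟨(ZMod.intCast_zmod_eq_zero_iff_dvd _ _).1 h.1,
      (ZMod.intCast_zmod_eq_zero_iff_dvd _ _).1 h.2⟩
  · simp [F, h0]
  · intro T
    by_cases hT : (∑ i ∈ T, (a i : ZMod p)) = 0 ∧ (∑ i ∈ T, (b i : ZMod p)) = 0
    · rw [hsum, (hpoly _ _).2 hT, zero_mul]
    · rw [hFz T hT, mul_zero]
  · rintro T ⟨i, hi, hiV⟩
    exact hFz T (hno T ⟨i, hi, (Finset.mem_filter.1 hiV).2⟩)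
end

section
/- Let p be a prime and let c_1, ..., c_{3p-2} be p-adic integers none of which is divisible by p. Then there exist distinct indices i_1, ..., i_t with 1 ≤ t ≤ p such that the p-adic valuation of c_{i_1} + ... + c_{i_t} is exactly 1. -/
open Polynomial in
lemma alt_sum {R ι : Type*} [CommRing R] [DecidableEq ι] (c : ι → R) (s : Finset ι) :
    ∀ P : R[X], P.natDegree ≤ s.card →
      ∑ S ∈ s.powerset, (-1 : R) ^ S.card * P.eval (∑ i ∈ S, c i)
        = (-1) ^ s.card * (s.card.factorial : R) * (∏ i ∈ s, c i) * P.coeff s.card := by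
  induction s using Finset.induction_on with
  | empty =>
    intro P _
    simp [Polynomial.coeff_zero_eq_eval_zero]
  | insert a s ha ih =>
    intro P hP
    rw [Finset.card_insert_of_notMem ha] at hP
    rw [Finset.sum_powerset_insert ha, ← Finset.sum_add_distrib]
    have hcoef : (taylor (c a) P).coeff s.card
        = P.coeff s.card + (s.card + 1) * c a * P.coeff (s.card + 1) := by
      rw [taylor_coeff]
      have hd : (hasseDeriv s.card P).natDegree < 2 := by
        have := natDegree_hasseDeriv_le P s.card
        omega
      rw [eval_eq_sum_range' hd]
      simp only [Finset.sum_range_succ, Finset.sum_range_zero, hasseDeriv_coeff]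
      rw [show 1 + s.card = s.card + 1 by ring, Nat.choose_succ_self_right]
      simp
      ring
    have hQ : (P - taylor (c a) P).natDegree ≤ s.card := by
      rw [natDegree_le_iff_coeff_eq_zero]
      intro m hm
      rw [coeff_sub]
      rcases Nat.lt_or_ge P.natDegree m with h | h
      · rw [coeff_eq_zero_of_natDegree_lt h,
          coeff_eq_zero_of_natDegree_lt (by rwa [natDegree_taylor]), sub_zero]
      · have : m = P.natDegree := by omega
        rw [this, coeff_taylor_natDegree, leadingCoeff, sub_self]
    have key := ih _ hQ
    rw [coeff_sub, hcoef] at key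
    rw [Finset.card_insert_of_notMem ha, Finset.prod_insert ha, Nat.factorial_succ]
    push_cast
    calc _ = ∑ S ∈ s.powerset, (-1 : R) ^ S.card * (P - taylor (c a) P).eval (∑ i ∈ S, c i) := by
            apply Finset.sum_congr rfl
            intro S hS
            have haS : a ∉ S := fun h => ha (Finset.mem_powerset.1 hS h)
            rw [Finset.card_insert_of_notMem haS, Finset.sum_insert haS, eval_sub, taylor_eval,
              add_comm (c a)]
            ring
      _ = _ := by
            rw [key]
            ring

open Polynomial in
noncomputable def HH (p : ℕ) [Fact p.Prime] : ℤ_[p][X] :=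
  ∏ j ∈ Finset.range (p - 1), (X - C ((j : ℤ_[p]) + 1))

open Polynomial in
lemma HH_monic (p : ℕ) [Fact p.Prime] : (HH p).Monic :=
  monic_prod_of_monic _ _ fun _ _ => monic_X_sub_C _

open Polynomial in
lemma HH_deg (p : ℕ) [Fact p.Prime] : (HH p).natDegree = p - 1 := by
  rw [HH, natDegree_prod_of_monic _ _ fun _ _ => monic_X_sub_C _]
  simp only [natDegree_X_sub_C, Finset.sum_const, Finset.card_range, smul_eq_mul, mul_one]

lemma HH_dvd (p : ℕ) [Fact p.Prime] (x : ℤ_[p]) (hx : ¬ (p : ℤ_[p]) ∣ x) :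
    (p : ℤ_[p]) ∣ (HH p).eval x := by
  obtain ⟨n, hn, h⟩ := PadicInt.exists_mem_range x
  rw [PadicInt.maximalIdeal_eq_span_p, Ideal.mem_span_singleton] at h
  have hn0 : n ≠ 0 := by
    rintro rfl
    simp at h
    exact hx h
  rw [HH, Polynomial.eval_prod]
  refine h.trans ?_
  have := Finset.dvd_prod_of_mem
    (fun j : ℕ => (Polynomial.X - Polynomial.C ((j : ℤ_[p]) + 1)).eval x)
    (Finset.mem_range.2 (show n - 1 < p - 1 by omega))
  convert this using 1
  obtain ⟨m, rfl⟩ := Nat.exists_eq_succ_of_ne_zero hn0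
  simp

lemma HH_zero (p : ℕ) [hp : Fact p.Prime] : ¬ (p : ℤ_[p]) ∣ (HH p).eval 0 := by
  rw [HH, Polynomial.eval_prod, (PadicInt.prime_p (p := p)).dvd_finsetProd_iff]
  rintro ⟨j, hj, h⟩
  rw [Finset.mem_range] at hj
  simp only [Polynomial.eval_sub, Polynomial.eval_X, Polynomial.eval_C, zero_sub, dvd_neg] at h
  have h2 : ((p : ℤ_[p]) ^ 1) ∣ (((j + 1 : ℕ) : ℤ) : ℤ_[p]) := by
    push_cast
    simpa using h
  rw [PadicInt.pow_p_dvd_int_iff] at h2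
  have h3 : p ∣ j + 1 := by exact_mod_cast (by simpa using h2 : (p : ℤ) ∣ ((j + 1 : ℕ) : ℤ))
  have := Nat.le_of_dvd (by omega) h3
  omega

/-- Davenport constant of the cyclic group of prime order. -/
lemma davenport (p : ℕ) [hp : Fact p.Prime] {ι : Type*} [DecidableEq ι] (c : ι → ℤ_[p])
    (s : Finset ι) (hs : s.card = p) :
    ∃ S ⊆ s, S.Nonempty ∧ (p : ℤ_[p]) ∣ ∑ i ∈ S, c i := by
  by_contra! hcon
  have hp1 := hp.out.one_lt
  have h := alt_sum c s (HH p) (by rw [HH_deg]; omega)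
  rw [Polynomial.coeff_eq_zero_of_natDegree_lt (by rw [HH_deg]; omega), mul_zero,
    ← Finset.sum_erase_add _ _ (Finset.empty_mem_powerset s)] at h
  simp only [Finset.card_empty, pow_zero, one_mul, Finset.sum_empty] at h
  apply HH_zero p
  rw [eq_neg_of_add_eq_zero_right h, dvd_neg]
  apply Finset.dvd_sum
  intro S hS
  rw [Finset.mem_erase, Finset.mem_powerset] at hS
  exact (HH_dvd p _ (hcon S hS.2 (Finset.nonempty_iff_ne_empty.2 hS.1))).mul_left _

lemma exists_sum (p : ℕ) [hp : Fact p.Prime] {ι : Type*} [DecidableEq ι] (c : ι → ℤ_[p])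
    (hc : ∀ i, ¬ (p : ℤ_[p]) ∣ c i) (s : Finset ι) (hs : s.card = 2 * p - 1) :
    ∃ S : Finset ι, (p : ℤ_[p]) ∣ ∑ i ∈ S, c i ∧ ¬ (p : ℤ_[p]) ^ 2 ∣ ∑ i ∈ S, c i := by
  by_contra! hcon
  have hp1 := hp.out.one_lt
  have hmon : (Polynomial.X * HH p ^ 2).Monic := Polynomial.monic_X.mul ((HH_monic p).pow 2)
  have hdeg : (Polynomial.X * HH p ^ 2).natDegree = 2 * p - 1 := by
    rw [Polynomial.monic_X.natDegree_mul ((HH_monic p).pow 2), (HH_monic p).natDegree_pow, HH_deg,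
      Polynomial.natDegree_X]
    omega
  have h := alt_sum c s (Polynomial.X * HH p ^ 2) (by omega)
  have hlead : (Polynomial.X * HH p ^ 2).coeff s.card = 1 := by
    rw [hs, ← hdeg]
    exact hmon
  rw [hlead, mul_one] at h
  have hd : (p : ℤ_[p]) ^ 2 ∣
      ∑ S ∈ s.powerset, (-1 : ℤ_[p]) ^ S.card
        * (Polynomial.X * HH p ^ 2).eval (∑ i ∈ S, c i) := by
    apply Finset.dvd_sum
    intro S _
    apply Dvd.dvd.mul_left
    rw [Polynomial.eval_mul, Polynomial.eval_X, Polynomial.eval_pow]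
    by_cases hS : (p : ℤ_[p]) ∣ ∑ i ∈ S, c i
    · exact (hcon S hS).mul_right _
    · exact (pow_dvd_pow_of_dvd (HH_dvd p _ hS) 2).mul_left _
  rw [h] at hd
  have hprod : ¬ (p : ℤ_[p]) ∣ ∏ i ∈ s, c i := by
    rw [(PadicInt.prime_p (p := p)).dvd_finsetProd_iff]
    rintro ⟨i, _, hi⟩
    exact hc i hi
  have h1 := (PadicInt.prime_p (p := p)).pow_dvd_of_dvd_mul_right 2 hprod hd
  have h2 : (p : ℤ_[p]) ^ 2 ∣ (s.card.factorial : ℤ_[p]) := by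
    rcases neg_one_pow_eq_or ℤ_[p] s.card with h | h <;> rw [h] at h1 <;> simpa using h1
  have h3 : (p : ℤ_[p]) ^ 2 ∣ ((s.card.factorial : ℤ) : ℤ_[p]) := by exact_mod_cast h2
  rw [PadicInt.pow_p_dvd_int_iff] at h3
  have h4 : p ^ 2 ∣ s.card.factorial := by exact_mod_cast h3
  rw [hs, hp.out.pow_dvd_factorial_iff (b := 2)
    (Nat.log_lt_of_lt_pow (by omega) (by
      zify [show 1 ≤ 2 * p by omega]; nlinarith))] at h4
  have h5 : (2 * p - 1) / p < 2 := Nat.div_lt_of_lt_mul (by omega)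
  simp at h4
  omega

theorem stmt_7 (p : ℕ) [Fact p.Prime] (c : Fin (3 * p - 2) → ℤ_[p])
    (hc : ∀ i, ¬ (p : ℤ_[p]) ∣ c i) :
    ∃ S : Finset (Fin (3 * p - 2)), S.Nonempty ∧ S.card ≤ p ∧
      (∑ i ∈ S, c i).valuation = 1 := by
  have hp1 := (Fact.out : p.Prime).one_lt
  obtain ⟨s, -, hs⟩ := Finset.exists_subset_card_eq
    (s := (Finset.univ : Finset (Fin (3 * p - 2)))) (n := 2 * p - 1) (by simp; omega)
  obtain ⟨S0, hS0⟩ := exists_sum p c hc s hs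
  obtain ⟨S, ⟨hS1, hS2⟩, hmin⟩ := WellFounded.has_min
    (measure (Finset.card : Finset (Fin (3 * p - 2)) → ℕ)).wf
    {S | (p : ℤ_[p]) ∣ ∑ i ∈ S, c i ∧ ¬ (p : ℤ_[p]) ^ 2 ∣ ∑ i ∈ S, c i} ⟨S0, hS0⟩
  refine ⟨S, ?_, ?_, ?_⟩
  · rw [Finset.nonempty_iff_ne_empty]
    rintro rfl
    simp at hS2
  · by_contra! hcard
    obtain ⟨T, hTS, hT⟩ := Finset.exists_subset_card_eq hcard.le
    obtain ⟨A, hAT, hAne, hA⟩ := davenport p c T hT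
    have hAS := hAT.trans hTS
    have hle := Finset.card_le_card hAT
    have hpos := hAne.card_pos
    have hsum := Finset.sum_sdiff (f := c) hAS
    have hcs := Finset.card_sdiff_add_card_eq_card hAS
    have hB : (p : ℤ_[p]) ∣ ∑ i ∈ S \ A, c i := by
      rw [← hsum] at hS1
      exact (dvd_add_left hA).1 hS1
    have hA2 : (p : ℤ_[p]) ^ 2 ∣ ∑ i ∈ A, c i := by
      by_contra hn
      exact hmin A ⟨hA, hn⟩ (show A.card < S.card by omega)
    have hB2 : (p : ℤ_[p]) ^ 2 ∣ ∑ i ∈ S \ A, c i := by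
      by_contra hn
      exact hmin (S \ A) ⟨hB, hn⟩ (show (S \ A).card < S.card by omega)
    exact hS2 (hsum ▸ dvd_add hB2 hA2)
  · have hne : ∑ i ∈ S, c i ≠ 0 := fun h => hS2 (h ▸ dvd_zero _)
    have e1 := PadicInt.mem_span_pow_iff_le_valuation _ hne 1
    have e2 := PadicInt.mem_span_pow_iff_le_valuation _ hne 2
    rw [Ideal.mem_span_singleton] at e1 e2
    rw [pow_one] at e1
    have := e1.1 hS1
    have := mt e2.2 hS2
    omega
end

section
/- Let p be a prime and let v_1, ..., v_{3p²-2} ∈ ℤ_p² be primitive vectors. Then there exist distinct indices i_1, ..., i_t with 1 ≤ t ≤ p such that both coordinates of v_{i_1} + ... + v_{i_t} are divisible by p, but at least one coordinate is not divisible by p². -/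
open Finset Pointwise in
lemma card_subset_sums (p : ℕ) [Fact p.Prime] {ι : Type*} [DecidableEq ι] (u : ι → ZMod p)
    (s : Finset ι) (hu : ∀ i ∈ s, u i ≠ 0) :
    min p (s.card + 1) ≤ (s.powerset.image (fun T => ∑ i ∈ T, u i)).card := by
  induction s using Finset.induction_on with
  | empty => simp
  | insert a s ha ih =>
    have ih' := ih (fun i hi => hu i (Finset.mem_insert_of_mem hi))
    have hua : (0 : ZMod p) ≠ u a := (hu a (Finset.mem_insert_self a s)).symm
    set A := s.powerset.image (fun T => ∑ i ∈ T, u i) with hA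
    have hAne : A.Nonempty := ⟨0, Finset.mem_image.2 ⟨∅, by simp, by simp⟩⟩
    have hcd := ZMod.cauchy_davenport (Fact.out : p.Prime) hAne
      (Finset.insert_nonempty (0 : ZMod p) {u a})
    rw [Finset.card_pair hua] at hcd
    have hsub : A + {0, u a} ⊆ (insert a s).powerset.image (fun T => ∑ i ∈ T, u i) := by
      intro x hx
      obtain ⟨y, hy, z, hz, rfl⟩ := Finset.mem_add.1 hx
      obtain ⟨T, hT, rfl⟩ := Finset.mem_image.1 hy
      have hT' := Finset.mem_powerset.1 hT
      rcases Finset.mem_insert.1 hz with rfl | hz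
      · exact Finset.mem_image.2 ⟨T, Finset.mem_powerset.2
          (hT'.trans (Finset.subset_insert _ _)), by simp⟩
      · rw [Finset.mem_singleton] at hz
        subst hz
        refine Finset.mem_image.2 ⟨insert a T, Finset.mem_powerset.2
          (Finset.insert_subset_insert _ hT'), ?_⟩
        rw [Finset.sum_insert (fun h => ha (hT' h)), add_comm]
    have h1 := Finset.card_le_card hsub
    rw [Finset.card_insert_of_notMem ha]
    omega

lemma exists_subset_sum (p : ℕ) [Fact p.Prime] {ι : Type*} [DecidableEq ι] (u : ι → ZMod p)
    (s : Finset ι) (hu : ∀ i ∈ s, u i ≠ 0) (hs : p ≤ s.card + 1) (r : ZMod p) :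
    ∃ T ⊆ s, ∑ i ∈ T, u i = r := by
  have h := card_subset_sums p u s hu
  rw [min_eq_left hs] at h
  have h2 : s.powerset.image (fun T => ∑ i ∈ T, u i) = Finset.univ := by
    apply Finset.eq_univ_of_card
    rw [ZMod.card]
    refine le_antisymm ?_ h
    simpa [ZMod.card] using Finset.card_le_univ (s.powerset.image (fun T => ∑ i ∈ T, u i))
  have h3 : r ∈ s.powerset.image (fun T => ∑ i ∈ T, u i) := h2 ▸ Finset.mem_univ r
  obtain ⟨T, hT, h⟩ := Finset.mem_image.1 h3
  exact ⟨T, Finset.mem_powerset.1 hT, h⟩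

lemma additive_of_three {G M : Type*} [AddCommGroup G] [AddCommGroup M] (f g h : G → M)
    (f0 : f 0 = 0) (g0 : g 0 = 0) (h0 : h 0 = 0)
    (H : ∀ r s t, r + s + t = 0 → f r + g s + h t = 0) (r s : G) : f (r + s) = f r + f s := by
  have h1 := H (r + s) 0 (-(r + s)) (by abel)
  have h2 := H r s (-(r + s)) (by abel)
  have h3 := H 0 s (-s) (by abel)
  have h4 := H s 0 (-s) (by abel)
  rw [g0, add_zero] at h1 h4
  rw [f0, zero_add] at h3
  have e1 : f (r + s) = f r + g s := add_right_cancel (h1.trans h2.symm)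
  have e2 : f s = g s := add_right_cancel (h4.trans h3.symm)
  rw [e1, e2]

lemma toZMod_zero_iff (p : ℕ) [Fact p.Prime] (x : ℤ_[p]) :
    PadicInt.toZMod x = 0 ↔ (p : ℤ_[p]) ∣ x := by
  rw [← RingHom.mem_ker, PadicInt.ker_toZMod, PadicInt.maximalIdeal_eq_span_p,
    Ideal.mem_span_singleton]

lemma toZModPow_zero_iff (p : ℕ) [Fact p.Prime] (x : ℤ_[p]) :
    PadicInt.toZModPow 2 x = 0 ↔ (p : ℤ_[p]) ^ 2 ∣ x := by
  rw [← RingHom.mem_ker, PadicInt.ker_toZModPow, Ideal.mem_span_singleton]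

lemma exists_good (p : ℕ) [Fact p.Prime] {ι : Type*} [DecidableEq ι] (u : ι → ℤ_[p])
    (s : Finset ι) (hu : ∀ i ∈ s, ¬ (p : ℤ_[p]) ∣ u i) (hs : 3 * (p - 1) ≤ s.card) :
    ∃ T ⊆ s, (p : ℤ_[p]) ∣ ∑ i ∈ T, u i ∧ ¬ (p : ℤ_[p]) ^ 2 ∣ ∑ i ∈ T, u i := by
  by_contra! P
  have hp1 := (Fact.out : p.Prime).one_lt
  obtain ⟨A, hA, cA⟩ := Finset.exists_subset_card_eq (show p - 1 ≤ s.card by omega)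
  have c1 := Finset.card_sdiff_add_card_eq_card hA
  obtain ⟨B, hB, cB⟩ := Finset.exists_subset_card_eq (show p - 1 ≤ (s \ A).card by omega)
  have c2 := Finset.card_sdiff_add_card_eq_card hB
  obtain ⟨C, hC, cC⟩ := Finset.exists_subset_card_eq (show p - 1 ≤ ((s \ A) \ B).card by omega)
  have hBs : B ⊆ s := hB.trans Finset.sdiff_subset
  have hCs : C ⊆ s := hC.trans (Finset.sdiff_subset.trans Finset.sdiff_subset)
  have hAB : Disjoint A B := Finset.disjoint_left.2 fun x hx hx' =>
    (Finset.mem_sdiff.1 (hB hx')).2 hx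
  have hAC : Disjoint A C := Finset.disjoint_left.2 fun x hx hx' =>
    (Finset.mem_sdiff.1 (Finset.mem_sdiff.1 (hC hx')).1).2 hx
  have hBC : Disjoint B C := Finset.disjoint_left.2 fun x hx hx' =>
    (Finset.mem_sdiff.1 (hC hx')).2 hx
  have key : ∀ D ⊆ s, D.card = p - 1 → ∀ r : ZMod p, ∃ T ⊆ D,
      PadicInt.toZMod (∑ i ∈ T, u i) = r := by
    intro D hD hc r
    obtain ⟨T, hT, h⟩ := exists_subset_sum p (fun i => PadicInt.toZMod (u i)) D
      (fun i hi h => hu i (hD hi) ((toZMod_zero_iff p _).1 h)) (by omega) r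
    exact ⟨T, hT, by rw [map_sum]; exact h⟩
  choose a haA ha using key A hA cA
  choose b hbB hb using key B hBs cB
  choose c hcC hc using key C hCs cC
  have P0 : ∀ T ⊆ s, PadicInt.toZMod (∑ i ∈ T, u i) = 0 →
      PadicInt.toZModPow 2 (∑ i ∈ T, u i) = 0 := fun T hT h =>
    (toZModPow_zero_iff p _).2 (P T hT ((toZMod_zero_iff p _).1 h))
  let F : ZMod p → ZMod (p ^ 2) := fun r => PadicInt.toZModPow 2 (∑ i ∈ a r, u i)
  have F0 : F 0 = 0 := P0 _ ((haA 0).trans hA) (ha 0)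
  have hadd : ∀ r t, F (r + t) = F r + F t := by
    refine additive_of_three F (fun r => PadicInt.toZModPow 2 (∑ i ∈ b r, u i))
      (fun r => PadicInt.toZModPow 2 (∑ i ∈ c r, u i)) F0
      (P0 _ ((hbB 0).trans hBs) (hb 0)) (P0 _ ((hcC 0).trans hCs) (hc 0)) ?_
    intro x y z hxyz
    have d1 : Disjoint (a x) (b y) := Finset.disjoint_of_subset_left (haA x)
      (Finset.disjoint_of_subset_right (hbB y) hAB)
    have d2 : Disjoint (a x ∪ b y) (c z) := Finset.disjoint_union_left.2
      ⟨Finset.disjoint_of_subset_left (haA x) (Finset.disjoint_of_subset_right (hcC z) hAC),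
       Finset.disjoint_of_subset_left (hbB y) (Finset.disjoint_of_subset_right (hcC z) hBC)⟩
    have e := P0 (a x ∪ b y ∪ c z) (Finset.union_subset (Finset.union_subset
      ((haA x).trans hA) ((hbB y).trans hBs)) ((hcC z).trans hCs))
    rw [Finset.sum_union d2, Finset.sum_union d1] at e
    simp only [map_add, ha, hb, hc] at e
    exact e hxyz
  have hn : ∀ n : ℕ, F (n : ZMod p) = n * F 1 := by
    intro n
    induction n with
    | zero => simpa using F0
    | succ k ih => rw [Nat.cast_succ, hadd, ih]; push_cast; ring
  have e := hn p
  rw [ZMod.natCast_self, F0] at e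
  have e2 : PadicInt.toZModPow 2 ((p : ℤ_[p]) * ∑ i ∈ a 1, u i) = 0 := by
    rw [map_mul, map_natCast]; exact e.symm
  rw [toZModPow_zero_iff, pow_two] at e2
  have hp0 : (p : ℤ_[p]) ≠ 0 := by exact_mod_cast (Fact.out : p.Prime).ne_zero
  have e3 := (toZMod_zero_iff p _).2 ((mul_dvd_mul_iff_left hp0).1 e2)
  rw [ha] at e3
  exact one_ne_zero e3

lemma shorten (p : ℕ) [Fact p.Prime] {ι : Type*} [DecidableEq ι] (u : ι → ℤ_[p])
    (n : ℕ) : ∀ T : Finset ι, T.card = n → (∀ i ∈ T, ¬ (p : ℤ_[p]) ∣ u i) →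
    (p : ℤ_[p]) ∣ ∑ i ∈ T, u i → ¬ (p : ℤ_[p]) ^ 2 ∣ ∑ i ∈ T, u i →
    ∃ S ⊆ T, S.card ≤ p ∧ (p : ℤ_[p]) ∣ ∑ i ∈ S, u i ∧ ¬ (p : ℤ_[p]) ^ 2 ∣ ∑ i ∈ S, u i := by
  induction n using Nat.strong_induction_on with
  | _ n ih =>
  intro T hT hu h1 h2
  have hp1 := (Fact.out : p.Prime).one_lt
  by_cases hle : T.card ≤ p
  · exact ⟨T, subset_rfl, hle, h1, h2⟩
  obtain ⟨x, hx⟩ := Finset.card_pos.1 (show 0 < T.card by omega)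
  have cx := Finset.card_erase_of_mem hx
  obtain ⟨D, hD, cD⟩ := Finset.exists_subset_card_eq (show p - 1 ≤ (T.erase x).card by omega)
  have hDT : D ⊆ T := hD.trans (Finset.erase_subset _ _)
  obtain ⟨U, hU, hUs⟩ := exists_subset_sum p (fun i => PadicInt.toZMod (u i)) D
      (fun i hi h => hu i (hDT hi) ((toZMod_zero_iff p _).1 h)) (by omega)
      (-PadicInt.toZMod (u x))
  have hxU : x ∉ U := fun h => by simpa using hD (hU h)
  have hV : insert x U ⊆ T := Finset.insert_subset hx (hU.trans hDT)
  have cV : (insert x U).card ≤ p := by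
    rw [Finset.card_insert_of_notMem hxU]
    have := Finset.card_le_card hU
    omega
  have hVs : (p : ℤ_[p]) ∣ ∑ i ∈ insert x U, u i := by
    rw [← toZMod_zero_iff, Finset.sum_insert hxU, map_add, map_sum, hUs]; ring
  by_cases hV2 : (p : ℤ_[p]) ^ 2 ∣ ∑ i ∈ insert x U, u i
  · have hsum := Finset.sum_sdiff (f := u) hV
    have hc := Finset.card_sdiff_add_card_eq_card hV
    have hpos : 0 < (insert x U).card := Finset.card_pos.2 (Finset.insert_nonempty _ _)
    obtain ⟨S, hS, r⟩ := ih (T \ insert x U).card (by omega) (T \ insert x U) rfl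
      (fun i hi => hu i (Finset.mem_sdiff.1 hi).1)
      ((dvd_add_left hVs).1 (hsum ▸ h1)) (fun h => h2 (hsum ▸ dvd_add h hV2))
    exact ⟨S, hS.trans Finset.sdiff_subset, r⟩
  · exact ⟨_, hV, cV, hVs, hV2⟩

lemma same_class (p : ℕ) [Fact p.Prime] {ι : Type*} [DecidableEq ι] (u : ι → ℤ_[p])
    (s : Finset ι) (hu : ∀ i ∈ s, ¬ (p : ℤ_[p]) ∣ u i) (hs : 3 * (p - 1) ≤ s.card) :
    ∃ S ⊆ s, S.Nonempty ∧ S.card ≤ p ∧ (p : ℤ_[p]) ∣ ∑ i ∈ S, u i ∧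
      ¬ (p : ℤ_[p]) ^ 2 ∣ ∑ i ∈ S, u i := by
  obtain ⟨T, hT, h1, h2⟩ := exists_good p u s hu hs
  obtain ⟨S, hS, h3, h4, h5⟩ := shorten p u _ T rfl (fun i hi => hu i (hT hi)) h1 h2
  refine ⟨S, hS.trans hT, ?_, h3, h4, h5⟩
  rw [Finset.nonempty_iff_ne_empty]
  rintro rfl
  simp at h5

theorem stmt_9 (p : ℕ) [Fact p.Prime] (v : Fin (3 * p ^ 2 - 2) → ℤ_[p] × ℤ_[p])
    (hprim : ∀ i, ¬ ((p : ℤ_[p]) ∣ (v i).1 ∧ (p : ℤ_[p]) ∣ (v i).2)) :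
    ∃ S : Finset (Fin (3 * p ^ 2 - 2)), S.Nonempty ∧ S.card ≤ p ∧
      (p : ℤ_[p]) ∣ (∑ i ∈ S, (v i).1) ∧ (p : ℤ_[p]) ∣ (∑ i ∈ S, (v i).2) ∧
      ¬ (((p : ℤ_[p]) ^ 2 ∣ (∑ i ∈ S, (v i).1)) ∧ ((p : ℤ_[p]) ^ 2 ∣ (∑ i ∈ S, (v i).2))) := by
  classical
  have hp1 := (Fact.out : p.Prime).one_lt
  let cl : Fin (3 * p ^ 2 - 2) → Option (ZMod p) := fun i =>
    if PadicInt.toZMod (v i).1 = 0 then none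
    else some (PadicInt.toZMod (v i).2 / PadicInt.toZMod (v i).1)
  obtain ⟨y, -, hy⟩ := Finset.exists_lt_card_fiber_of_mul_lt_card_of_maps_to
    (s := Finset.univ) (t := Finset.univ) (f := cl) (n := 3 * (p - 1))
    (fun _ _ => Finset.mem_univ _) (by
      simp only [Finset.card_univ, Fintype.card_option, ZMod.card, Fintype.card_fin]
      obtain ⟨q, rfl⟩ : ∃ q, p = q + 1 := ⟨p - 1, by omega⟩
      have : 3 * (q + 1) ^ 2 = (q + 1 + 1) * (3 * (q + 1 - 1)) + 3 := by
        simp only [Nat.add_sub_cancel]; ring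
      omega)
  cases y with
  | none =>
    have hz : ∀ i ∈ Finset.univ.filter (fun i => cl i = none), (p : ℤ_[p]) ∣ (v i).1 := by
      intro i hi
      have hi := (Finset.mem_filter.1 hi).2
      by_contra h
      rw [← toZMod_zero_iff] at h
      simp [cl, h] at hi
    obtain ⟨S, hS, h1, h2, h3, h4⟩ := same_class p (fun i => (v i).2) _
      (fun i hi h => hprim i ⟨hz i hi, h⟩) hy.le
    exact ⟨S, h1, h2, Finset.dvd_sum fun i hi => hz i (hS hi), h3, fun h => h4 h.2⟩
  | some m =>
    have hz : ∀ i ∈ Finset.univ.filter (fun i => cl i = some m), ¬ (p : ℤ_[p]) ∣ (v i).1 ∧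
        PadicInt.toZMod (v i).2 = m * PadicInt.toZMod (v i).1 := by
      intro i hi
      have hi := (Finset.mem_filter.1 hi).2
      by_cases h : PadicInt.toZMod (v i).1 = 0
      · simp [cl, h] at hi
      · simp only [cl, h, if_false, Option.some.injEq] at hi
        refine ⟨fun h' => h ((toZMod_zero_iff p _).2 h'), ?_⟩
        rw [← hi, div_mul_cancel₀ _ h]
    obtain ⟨S, hS, h1, h2, h3, h4⟩ := same_class p (fun i => (v i).1) _
      (fun i hi => (hz i hi).1) hy.le
    refine ⟨S, h1, h2, h3, ?_, fun h => h4 h.1⟩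
    rw [← toZMod_zero_iff, map_sum, Finset.sum_congr rfl fun i hi => (hz i (hS hi)).2,
      ← Finset.mul_sum, ← map_sum, (toZMod_zero_iff p _).2 h3, mul_zero]
end

section
/- Let p be a prime and suppose every sequence of C_0·p elements of 𝔽_p³ contains a zero-sum subsequence of length exactly p. Let C = C_0 + 2 and let v_1, ..., v_{Cp} ∈ ℤ_p² be primitive vectors. Then there exist distinct indices i_1, ..., i_t with 1 ≤ t ≤ p such that both coordinates of v_{i_1} + ... + v_{i_t} are divisible by p, but at least one coordinate is not divisible by p². -/
open scoped Pointwise in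
lemma cover_card {p : ℕ} [Fact p.Prime] {ι : Type*} [DecidableEq ι] (a : ι → ZMod p)
    (A : Finset ι) (ha : ∀ i ∈ A, a i ≠ 0) :
    min p (A.card + 1) ≤ (A.powerset.image (fun T => ∑ i ∈ T, a i)).card := by
  induction A using Finset.induction_on with
  | empty => simp
  | insert e A he ih =>
    have ih := ih (fun i hi => ha i (Finset.mem_insert_of_mem hi))
    have hae : a e ≠ 0 := ha e (Finset.mem_insert_self _ _)
    set X := A.powerset.image (fun T => ∑ i ∈ T, a i) with hX
    have hne : X.Nonempty := ⟨0, by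
      rw [hX, Finset.mem_image]
      exact ⟨∅, by simp, by simp⟩⟩
    have hcd := ZMod.cauchy_davenport (Fact.out : p.Prime) hne
      (t := {0, a e}) (by simp)
    rw [Finset.card_pair (Ne.symm hae)] at hcd
    have hsub : X + {0, a e} ⊆
        (insert e A).powerset.image (fun T => ∑ i ∈ T, a i) := by
      intro z hz
      obtain ⟨x, hx, y, hy, rfl⟩ := Finset.mem_add.1 hz
      rw [hX, Finset.mem_image] at hx
      obtain ⟨T, hT, rfl⟩ := hx
      rw [Finset.mem_powerset] at hT
      rw [Finset.mem_image]
      simp only [Finset.mem_insert, Finset.mem_singleton] at hy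
      rcases hy with rfl | rfl
      · exact ⟨T, Finset.mem_powerset.2 (hT.trans (Finset.subset_insert _ _)), by simp⟩
      · refine ⟨insert e T, Finset.mem_powerset.2 (Finset.insert_subset_insert _ hT), ?_⟩
        rw [Finset.sum_insert (fun h => he (hT h)), add_comm]
    have := Finset.card_le_card hsub
    rw [Finset.card_insert_of_notMem he]
    omega

lemma cover {p : ℕ} [Fact p.Prime] {ι : Type*} [DecidableEq ι] (a : ι → ZMod p)
    (A : Finset ι) (ha : ∀ i ∈ A, a i ≠ 0) (hA : p ≤ A.card + 1) (r : ZMod p) :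
    ∃ T ⊆ A, ∑ i ∈ T, a i = r := by
  have h := cover_card a A ha
  rw [min_eq_left hA] at h
  have h2 : A.powerset.image (fun T => ∑ i ∈ T, a i) = Finset.univ := by
    rw [← Finset.card_eq_iff_eq_univ]
    apply le_antisymm (Finset.card_le_univ _)
    rw [ZMod.card]; exact h
  have h3 := Finset.mem_univ r
  rw [← h2, Finset.mem_image] at h3
  obtain ⟨T, hT, h4⟩ := h3
  exact ⟨T, Finset.mem_powerset.1 hT, h4⟩

lemma dvd_iff_toZMod {p : ℕ} [Fact p.Prime] (x : ℤ_[p]) :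
    (p : ℤ_[p]) ∣ x ↔ PadicInt.toZMod x = 0 := by
  rw [← RingHom.mem_ker, PadicInt.ker_toZMod, PadicInt.maximalIdeal_eq_span_p,
    Ideal.mem_span_singleton]

lemma unit_case {p : ℕ} [Fact p.Prime] {ι : Type*} [DecidableEq ι] (y : ι → ℤ_[p])
    (s : Finset ι) (hy : ∀ i ∈ s, ¬ (p : ℤ_[p]) ∣ y i) (hs : 2 * p ≤ s.card + 1) :
    ∃ T ⊆ s, T.Nonempty ∧ T.card ≤ p ∧ (p : ℤ_[p]) ∣ ∑ i ∈ T, y i ∧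
      ¬ (p : ℤ_[p]) ^ 2 ∣ ∑ i ∈ T, y i := by
  by_contra hcon
  push Not at hcon
  have hp : p.Prime := Fact.out
  have hp2 := hp.two_le
  set a : ι → ZMod p := fun i => PadicInt.toZMod (y i) with ha_def
  have ha : ∀ i ∈ s, a i ≠ 0 := fun i hi h => hy i hi ((dvd_iff_toZMod _).2 h)
  have hsum : ∀ T : Finset ι, (p : ℤ_[p]) ∣ ∑ i ∈ T, y i ↔ ∑ i ∈ T, a i = 0 := by
    intro T
    rw [dvd_iff_toZMod, map_sum]
  -- drop the cardinality bound
  have key : ∀ n : ℕ, ∀ T ⊆ s, T.card = n → ∑ i ∈ T, a i = 0 →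
      (p : ℤ_[p]) ^ 2 ∣ ∑ i ∈ T, y i := by
    intro n
    induction n using Nat.strong_induction_on with
    | _ n ih =>
      intro T hT hn h0
      rcases T.eq_empty_or_nonempty with rfl | hne
      · simp
      by_cases hc : T.card ≤ p
      · exact hcon T hT hne hc ((hsum T).2 h0)
      obtain ⟨P, hPT, hPc⟩ := Finset.exists_subset_card_eq (s := T) (n := p) (by omega)
      obtain ⟨e, he⟩ : P.Nonempty := Finset.card_pos.1 (by omega)
      obtain ⟨Q, hQ, hQs⟩ := cover a (P.erase e)
        (fun i hi => ha i (hT (hPT (Finset.mem_of_mem_erase hi))))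
        (by rw [Finset.card_erase_of_mem he]; omega) (-a e)
      have heQ : e ∉ Q := fun h => Finset.notMem_erase e P (hQ h)
      have hRP : insert e Q ⊆ P :=
        Finset.insert_subset he (hQ.trans (Finset.erase_subset _ _))
      have hR0 : ∑ i ∈ insert e Q, a i = 0 := by
        rw [Finset.sum_insert heQ, hQs, add_neg_cancel]
      have hRT := hRP.trans hPT
      have hRc := Finset.card_le_card hRP
      have hRpos : 0 < (insert e Q).card := Finset.card_pos.2 (Finset.insert_nonempty _ _)
      have h1 := ih _ (by omega) (insert e Q) (hRT.trans hT) rfl hR0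
      have h2 := ih (T \ insert e Q).card (by
        rw [Finset.card_sdiff_of_subset hRT]; omega) (T \ insert e Q)
        (Finset.sdiff_subset.trans hT) rfl (by
          have := Finset.sum_sdiff hRT (f := a)
          rw [hR0, h0, add_zero] at this
          exact this)
      rw [← Finset.sum_sdiff hRT]
      exact dvd_add h2 h1
  obtain ⟨A, hAs, hAc⟩ := Finset.exists_subset_card_eq (s := s) (n := p - 1) (by omega)
  set B := s \ A with hB
  have hBs : B ⊆ s := Finset.sdiff_subset
  have hBc : p ≤ B.card := by
    rw [hB, Finset.card_sdiff_of_subset hAs]; omega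
  choose T hTA hTs using cover a A (fun i hi => ha i (hAs hi)) (by omega)
  have hF : ∀ U ⊆ B, (p : ℤ_[p]) ^ 2 ∣
      ∑ i ∈ U, y i + ∑ i ∈ T (-∑ i ∈ U, a i), y i := by
    intro U hU
    have hd : Disjoint U (T (-∑ i ∈ U, a i)) :=
      Finset.disjoint_of_subset_left hU
        (Finset.disjoint_of_subset_right (hTA _) Finset.sdiff_disjoint)
    rw [← Finset.sum_union hd]
    refine key _ _ (Finset.union_subset (hU.trans hBs) ((hTA _).trans hAs)) rfl ?_
    rw [Finset.sum_union hd, hTs, add_neg_cancel]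
  obtain ⟨b, hb⟩ : B.Nonempty := Finset.card_pos.1 (by omega)
  set F : ZMod p → ℤ_[p] := fun r => ∑ i ∈ T (-r), y i with hFdef
  have hstep : ∀ r, (p : ℤ_[p]) ^ 2 ∣ y b + F (r + a b) - F r := by
    intro r
    obtain ⟨U, hU, hUs⟩ := cover a (B.erase b)
      (fun i hi => ha i (hBs (Finset.mem_of_mem_erase hi)))
      (by rw [Finset.card_erase_of_mem hb]; omega) r
    have hbU : b ∉ U := fun h => Finset.notMem_erase b B (hU h)
    have hUB := hU.trans (Finset.erase_subset _ _)
    have h1 := hF U hUB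
    have h2 := hF (insert b U) (Finset.insert_subset hb hUB)
    rw [Finset.sum_insert hbU, Finset.sum_insert hbU, hUs, add_comm (a b)] at h2
    rw [hUs] at h1
    have h3 := dvd_sub h2 h1
    convert h3 using 1
    simp only [hFdef]
    ring
  have hiter : ∀ n : ℕ, (p : ℤ_[p]) ^ 2 ∣ n * y b + F (n * a b) - F 0 := by
    intro n
    induction n with
    | zero => simp
    | succ n ih =>
      have h := dvd_add ih (hstep (n * a b))
      have e : ((n + 1 : ℕ) : ZMod p) * a b = n * a b + a b := by push_cast; ring
      rw [e]
      convert h using 1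
      push_cast
      ring
  have h := hiter p
  simp only [CharP.cast_eq_zero, zero_mul, add_sub_cancel_right] at h
  rw [pow_two] at h
  have hp0 : (p : ℤ_[p]) ≠ 0 := by exact_mod_cast hp.ne_zero
  exact hy b (hBs hb) ((mul_dvd_mul_iff_left hp0).1 h)

theorem stmt_11 (p : ℕ) [Fact p.Prime] (C₀ : ℕ)
    (hAD : ∀ w : Fin (C₀ * p) → (Fin 3 → ZMod p),
      ∃ S : Finset (Fin (C₀ * p)), S.card = p ∧ ∑ i ∈ S, w i = 0)
    (v : Fin ((C₀ + 2) * p) → ℤ_[p] × ℤ_[p])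
    (hprim : ∀ i, ¬ ((p : ℤ_[p]) ∣ (v i).1 ∧ (p : ℤ_[p]) ∣ (v i).2)) :
    ∃ S : Finset (Fin ((C₀ + 2) * p)), S.Nonempty ∧ S.card ≤ p ∧
      (p : ℤ_[p]) ∣ (∑ i ∈ S, (v i).1) ∧ (p : ℤ_[p]) ∣ (∑ i ∈ S, (v i).2) ∧
      ¬ (((p : ℤ_[p]) ^ 2 ∣ (∑ i ∈ S, (v i).1)) ∧ ((p : ℤ_[p]) ^ 2 ∣ (∑ i ∈ S, (v i).2))) := by
  classical
  have hp : p.Prime := Fact.out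
  set N := Finset.univ.filter (fun i => ¬ (p : ℤ_[p]) ∣ (v i).1) with hN
  by_cases hc : C₀ * p ≤ N.card
  · obtain ⟨M, hMN, hMc⟩ := Finset.exists_subset_card_eq hc
    let e := (M.orderEmbOfFin hMc).toEmbedding
    have he : ∀ j, ¬ (p : ℤ_[p]) ∣ (v (e j)).1 := fun j =>
      (Finset.mem_filter.1 (hMN (M.orderEmbOfFin_mem hMc j))).2
    have hrep : ∀ x : ℤ_[p], ∃ b : ℤ_[p], x = (x.zmodRepr : ℤ_[p]) + p * b := by
      intro x
      have h := PadicInt.sub_zmodRepr_mem x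
      rw [PadicInt.maximalIdeal_eq_span_p, Ideal.mem_span_singleton] at h
      obtain ⟨b, hb⟩ := h
      exact ⟨b, by rw [← hb]; ring⟩
    choose β hβ using hrep
    obtain ⟨S, hSc, hS⟩ := hAD (fun j => ![PadicInt.toZMod (v (e j)).1,
      PadicInt.toZMod (v (e j)).2, PadicInt.toZMod (β (v (e j)).1)])
    have h0 := congrFun hS 0
    have h1 := congrFun hS 1
    have h2 := congrFun hS 2
    simp only [Finset.sum_apply, Matrix.cons_val, Pi.zero_apply, ← map_sum] at h0 h1 h2
    rw [← dvd_iff_toZMod] at h0 h1 h2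
    have hSne : S.Nonempty := Finset.card_pos.1 (by rw [hSc]; exact hp.pos)
    refine ⟨S.map e, by simpa using hSne, by simp [hSc], by simpa using h0,
      by simpa using h1, ?_⟩
    rintro ⟨h3, -⟩
    rw [Finset.sum_map] at h3
    have h4 : ∑ j ∈ S, (v (e j)).1 =
        ((∑ j ∈ S, (v (e j)).1.zmodRepr : ℕ) : ℤ_[p]) + p * ∑ j ∈ S, β (v (e j)).1 := by
      rw [Finset.mul_sum]
      push_cast
      rw [← Finset.sum_add_distrib]
      exact Finset.sum_congr rfl (fun j _ => hβ _)
    rw [h4] at h3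
    have h5 : (p : ℤ_[p]) ^ 2 ∣ p * ∑ j ∈ S, β (v (e j)).1 := by
      rw [pow_two]; exact mul_dvd_mul_left _ h2
    have h6 := (dvd_add_left h5).1 h3
    have h7 : p ^ 2 ∣ ∑ j ∈ S, (v (e j)).1.zmodRepr := by
      have h8 := (PadicInt.pow_p_dvd_int_iff (p := p) 2
        ((∑ j ∈ S, (v (e j)).1.zmodRepr : ℕ) : ℤ)).1 (by simpa using h6)
      exact_mod_cast h8
    have hpos : 0 < ∑ j ∈ S, (v (e j)).1.zmodRepr := by
      apply Finset.sum_pos _ hSne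
      intro j _
      apply Nat.pos_of_ne_zero
      intro hz
      apply he j
      have := hβ (v (e j)).1
      rw [hz, Nat.cast_zero, zero_add] at this
      exact ⟨_, this⟩
    have hlt : ∑ j ∈ S, (v (e j)).1.zmodRepr < p ^ 2 := by
      calc _ < ∑ j ∈ S, p := Finset.sum_lt_sum_of_nonempty hSne
              (fun j _ => PadicInt.zmodRepr_lt_p _)
        _ = p ^ 2 := by simp [hSc, pow_two]
    exact absurd (Nat.le_of_dvd hpos h7) (by omega)
  · have hcard := Finset.card_compl N
    rw [Fintype.card_fin] at hcard
    have hmul := add_mul C₀ 2 p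
    have hmem : ∀ i ∈ Nᶜ, (p : ℤ_[p]) ∣ (v i).1 := by
      intro i hi
      by_contra h
      exact Finset.mem_compl.1 hi (by simp [hN, h])
    obtain ⟨T, hT, hne, hTc, hd, hnd⟩ := unit_case (fun i => (v i).2) Nᶜ
      (fun i hi h => hprim i ⟨hmem i hi, h⟩) (by omega)
    exact ⟨T, hne, hTc, Finset.dvd_sum (fun i hi => hmem i (hT hi)), hd, fun h => hnd h.2⟩
end
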